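/- For every n ≥ 1, the natural homomorphism Aut(F_n) → Aut(F_n^{ab}) ≅ GL_n(ℤ), sending an automorphism of the free group F_n to the induced automorphism of its abelianization, is surjective. Equivalently, every automorphism of the free abelian group ℤⁿ lifts to an automorphism of F_n. -/

import Mathlib

abbrev FG (n : ℕ) := FreeGroup (Fin n)

/-- The homomorphism sending an automorphism of the free group to the induced
automorphism of its abelianization. -/
def theta (n : ℕ) : MulAut (FG n) →* MulAut (Abelianization (FG n)) where
  toFun f := f.abelianizationCongr
  map_one' := abelianizationCongr_refl
  map_mul' f g := (abelianizationCongr_trans g f).symm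

namespace AutAb

abbrev V (n : ℕ) := Fin n →₀ ℤ

/-- the abelianization map in coordinates -/
noncomputable def q (n : ℕ) : FG n →* Multiplicative (V n) :=
  FreeGroup.lift (fun i => Multiplicative.ofAdd (Finsupp.single i 1))

def Lift {n : ℕ} (φ : V n ≃+ V n) : Prop :=
  ∃ f : MulAut (FG n), ∀ x, (q n (f x)).toAdd = φ (q n x).toAdd

lemma q_of {n : ℕ} (i : Fin n) :
    q n (FreeGroup.of i) = Multiplicative.ofAdd (Finsupp.single i 1) := by
  simp [q]

lemma lift_of_gen {n : ℕ} (φ : V n ≃+ V n) (f : MulAut (FG n))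
    (h : ∀ i, (q n (f (FreeGroup.of i))).toAdd = φ (Finsupp.single i 1)) : Lift φ := by
  refine ⟨f, fun x => ?_⟩
  have : (q n).comp f.toMonoidHom = (AddMonoidHom.toMultiplicative φ.toAddMonoidHom).comp (q n) := by
    apply FreeGroup.ext_hom
    intro i
    apply Multiplicative.toAdd.injective
    simpa [q_of] using h i
  exact congrArg Multiplicative.toAdd (DFunLike.congr_fun this x)

lemma Lift.trans {n : ℕ} {φ ψ : V n ≃+ V n} (h : Lift φ) (h' : Lift ψ) : Lift (φ.trans ψ) := by
  obtain ⟨f, hf⟩ := h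
  obtain ⟨g, hg⟩ := h'
  exact ⟨MulEquiv.trans f g, fun x => by simp [hf, hg]⟩

lemma Lift.of_trans {n : ℕ} {φ ψ : V n ≃+ V n} (h : Lift ψ.symm) (h' : Lift (φ.trans ψ)) :
    Lift φ := by
  have := h'.trans h
  convert this using 1
  ext1 x
  simp

/-- elementary transvection -/
noncomputable def T {n : ℕ} (i j : Fin n) (hij : i ≠ j) (c : ℤ) : V n ≃+ V n where
  toFun v := v + Finsupp.single i (c * v j)
  invFun v := v + Finsupp.single i (-c * v j)
  left_inv v := by
    ext l
    simp [Finsupp.single_apply, hij]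
  right_inv v := by
    ext l
    simp [Finsupp.single_apply, hij]
  map_add' v w := by
    ext l
    simp only [Finsupp.add_apply, Finsupp.single_apply]
    split_ifs <;> ring

lemma T_apply {n : ℕ} (i j : Fin n) (hij : i ≠ j) (c : ℤ) (v : V n) :
    T i j hij c v = v + Finsupp.single i (c * v j) := rfl

lemma T_symm {n : ℕ} (i j : Fin n) (hij : i ≠ j) (c : ℤ) :
    (T i j hij c).symm = T i j hij (-c) := by
  ext1 v; rfl

def tHom {n : ℕ} (i j : Fin n) (c : ℤ) : FG n →* FG n :=
  FreeGroup.lift (fun l => if l = j then FreeGroup.of j * FreeGroup.of i ^ c else FreeGroup.of l)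

lemma tHom_comp {n : ℕ} (i j : Fin n) (hij : i ≠ j) (c d : ℤ) (h : c + d = 0) :
    (tHom i j c).comp (tHom i j d) = MonoidHom.id _ := by
  apply FreeGroup.ext_hom
  intro l
  by_cases hl : l = j
  · subst hl
    simp [tHom, hij, mul_assoc, ← zpow_add, h]
  · simp [tHom, hl]

def tAut {n : ℕ} (i j : Fin n) (hij : i ≠ j) (c : ℤ) : MulAut (FG n) :=
  MonoidHom.toMulEquiv (tHom i j c) (tHom i j (-c)) (tHom_comp i j hij _ _ (by ring))
    (tHom_comp i j hij _ _ (by ring))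

lemma lift_T {n : ℕ} (i j : Fin n) (hij : i ≠ j) (c : ℤ) : Lift (T i j hij c) := by
  apply lift_of_gen _ (tAut i j hij c)
  intro l
  by_cases hl : l = j
  · subst hl
    simp [tAut, tHom, T_apply, q_of]
  · simp [tAut, tHom, T_apply, q_of, hl]

lemma lift_T_symm {n : ℕ} (i j : Fin n) (hij : i ≠ j) (c : ℤ) : Lift (T i j hij c).symm := by
  rw [T_symm]; exact lift_T ..

/-- sign change -/
noncomputable def S {n : ℕ} (i : Fin n) : V n ≃+ V n where
  toFun v := v + Finsupp.single i (-2 * v i)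
  invFun v := v + Finsupp.single i (-2 * v i)
  left_inv v := by
    ext l
    simp only [Finsupp.add_apply, Finsupp.single_apply]
    split_ifs <;> simp_all <;> ring
  right_inv v := by
    ext l
    simp only [Finsupp.add_apply, Finsupp.single_apply]
    split_ifs <;> simp_all <;> ring
  map_add' v w := by
    ext l
    simp only [Finsupp.add_apply, Finsupp.single_apply]
    split_ifs <;> ring

lemma S_apply {n : ℕ} (i : Fin n) (v : V n) :
    S i v = v + Finsupp.single i (-2 * v i) := rfl

lemma S_symm {n : ℕ} (i : Fin n) : (S i).symm = S i := by
  ext1 v; rfl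

def sHom {n : ℕ} (i : Fin n) : FG n →* FG n :=
  FreeGroup.lift (fun l => if l = i then (FreeGroup.of i)⁻¹ else FreeGroup.of l)

lemma sHom_comp {n : ℕ} (i : Fin n) : (sHom i).comp (sHom i) = MonoidHom.id _ := by
  apply FreeGroup.ext_hom
  intro l
  by_cases hl : l = i
  · subst hl
    simp [sHom]
  · simp [sHom, hl]

def sAut {n : ℕ} (i : Fin n) : MulAut (FG n) :=
  MonoidHom.toMulEquiv (sHom i) (sHom i) (sHom_comp i) (sHom_comp i)

lemma lift_S {n : ℕ} (i : Fin n) : Lift (S i) := by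
  apply lift_of_gen _ (sAut i)
  intro l
  by_cases hl : l = i
  · subst hl
    simp only [sAut, sHom, S_apply, MonoidHom.toMulEquiv_apply, FreeGroup.lift_apply_of, if_true,
      map_inv, q_of, toAdd_inv, toAdd_ofAdd]
    ext m
    simp only [Finsupp.add_apply, Finsupp.neg_apply, Finsupp.single_apply]
    split_ifs <;> simp
  · simp [sAut, sHom, S_apply, q_of, hl]

/-- Finish clearing the column once the `k` entry is `1` and other entries above are zero:
clear the entries below, one at a time. -/
lemma clear_below {n : ℕ} (k : Fin n)
    (ih : ∀ φ : V n ≃+ V n, (∀ j, k ≤ j → φ (Finsupp.single j 1) = Finsupp.single j 1) → Lift φ)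
    (s : Finset (Fin n)) : ∀ φ : V n ≃+ V n,
      (∀ j, k < j → φ (Finsupp.single j 1) = Finsupp.single j 1) →
      φ (Finsupp.single k 1) k = 1 →
      (∀ i, i ≠ k → i ∉ s → φ (Finsupp.single k 1) i = 0) → Lift φ := by
  induction s using Finset.induction_on with
  | empty =>
    intro φ h1 h2 h3
    apply ih
    intro j hj
    rcases hj.eq_or_lt with rfl | hj
    · ext l
      rw [Finsupp.single_apply]
      split_ifs with hl
      · subst hl; exact h2
      · exact h3 l (Ne.symm hl) (by simp)
    · exact h1 j hj
  | insert a s ha hs =>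
    intro φ h1 h2 h3
    by_cases hak : a = k
    · exact hs φ h1 h2 fun i hi his => h3 i hi (by simp [his, hak, hi])
    · refine Lift.of_trans (lift_T_symm a k hak (-(φ (Finsupp.single k 1) a))) (hs _ ?_ ?_ ?_)
      · intro j hj
        simp [T_apply, h1 j hj, hj.ne']
      · simp [T_apply, h2, hak]
      · intro i hi his
        by_cases hia : i = a
        · subst hia
          simp [T_apply, h2]
        · simp [T_apply, hia, Ne.symm hia, h3 i hi (by simp [hia, his])]

lemma column {n : ℕ} (k : Fin n)
    (ih : ∀ φ : V n ≃+ V n, (∀ j, k ≤ j → φ (Finsupp.single j 1) = Finsupp.single j 1) → Lift φ)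
    (s : ℕ) : ∀ φ : V n ≃+ V n,
      (∀ j, k < j → φ (Finsupp.single j 1) = Finsupp.single j 1) →
      (∑ i ∈ Finset.Iic k, (φ (Finsupp.single k 1) i).natAbs = s) → Lift φ := by
  induction s using Nat.strong_induction_on with
  | _ s hs =>
  intro φ h1 h2
  by_cases h : ∃ i j, i ≤ k ∧ j ≤ k ∧ i ≠ j ∧ φ (Finsupp.single k 1) i ≠ 0 ∧
      φ (Finsupp.single k 1) j ≠ 0 ∧
      (φ (Finsupp.single k 1) i).natAbs ≤ (φ (Finsupp.single k 1) j).natAbs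
  · obtain ⟨i, j, hi, hj, hij, hvi, hvj, hle⟩ := h
    set v := φ (Finsupp.single k 1) with hv
    refine Lift.of_trans (lift_T_symm j i hij.symm (-(v j / v i))) (hs _ ?_ _ ?_ rfl)
    · rw [← h2]
      apply Finset.sum_lt_sum
      · intro l hl
        by_cases hlj : l = j
        · subst hlj
          simp only [AddEquiv.trans_apply, ← hv, T_apply, Finsupp.add_apply, Finsupp.single_eq_same]
          have : v l + -(v l / v i) * v i = v l % v i := by
            rw [Int.emod_def]; ring
          rw [this]
          have h5 := Int.emod_nonneg (v l) hvi
          have h6 := Int.emod_lt_abs (v l) hvi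
          rw [Int.abs_eq_natAbs] at h6
          omega
        · simp [T_apply, ← hv, Ne.symm hlj, hlj]
      · refine ⟨j, by simpa using hj, ?_⟩
        simp only [AddEquiv.trans_apply, ← hv, T_apply, Finsupp.add_apply, Finsupp.single_eq_same]
        have : v j + -(v j / v i) * v i = v j % v i := by
          rw [Int.emod_def]; ring
        rw [this]
        have h5 := Int.emod_nonneg (v j) hvi
        have h6 := Int.emod_lt_abs (v j) hvi
        rw [Int.abs_eq_natAbs] at h6
        omega
    · intro l hl
      simp [T_apply, h1 l hl, (lt_of_le_of_lt hi hl).ne, (lt_of_le_of_lt hi hl).ne']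
  · -- at most one nonzero entry
    have huniq : ∀ i j, i ≤ k → j ≤ k → φ (Finsupp.single k 1) i ≠ 0 →
        φ (Finsupp.single k 1) j ≠ 0 → i = j := by
      intro i j hi hj hvi hvj
      by_contra hij
      rcases le_total (φ (Finsupp.single k 1) i).natAbs (φ (Finsupp.single k 1) j).natAbs with h' | h'
      · exact h ⟨i, j, hi, hj, hij, hvi, hvj, h'⟩
      · exact h ⟨j, i, hj, hi, Ne.symm hij, hvj, hvi, h'⟩
    clear h
    obtain ⟨a, hak, ha⟩ : ∃ a, a ≤ k ∧ ∀ i, i ≤ k → i ≠ a → φ (Finsupp.single k 1) i = 0 := by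
      by_cases h : ∃ a, a ≤ k ∧ φ (Finsupp.single k 1) a ≠ 0
      · obtain ⟨a, h3, h4⟩ := h
        refine ⟨a, h3, fun i hi hia => ?_⟩
        by_contra h5
        exact hia (huniq i a hi h3 h5 h4)
      · push Not at h
        exact ⟨k, le_rfl, fun i hi _ => h i hi⟩
    -- the entry is a unit
    have hunit : φ (Finsupp.single k 1) a * φ.symm (Finsupp.single a 1) k = 1 := by
      set v := φ (Finsupp.single k 1) with hv
      have e1 : φ.symm v = Finsupp.single k 1 := by simp [hv]
      have e2 : v = ∑ i, v i • (Finsupp.single i (1:ℤ) : V n) := by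
        ext l
        simp [Finsupp.finsetSum_apply, Finsupp.single_apply]
      have e3 : φ.symm v k = ∑ i, v i * φ.symm (Finsupp.single i 1) k := by
        conv_lhs => rw [e2]
        rw [map_sum, Finsupp.finsetSum_apply]
        simp only [map_zsmul, Finsupp.smul_apply, smul_eq_mul]
      rw [e1, Finsupp.single_eq_same, Finset.sum_eq_single a] at e3
      · exact e3.symm
      · intro b _ hb
        rcases le_or_gt b k with hbk | hbk
        · rw [ha b hbk hb, zero_mul]
        · have : φ.symm (Finsupp.single b 1) = Finsupp.single b 1 := by
            rw [AddEquiv.symm_apply_eq, h1 b hbk]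
          rw [this, Finsupp.single_eq_of_ne hbk.ne, mul_zero]
      · simp
    have hsq := Int.isUnit_iff.1 (IsUnit.of_mul_eq_one _ hunit)
    by_cases hk : a = k
    · subst hk
      rcases hsq with hc | hc
      · refine clear_below a ih (Finset.Ioi a) φ h1 hc fun i hi his => ?_
        exact ha i (by simpa using his) hi
      · refine Lift.of_trans (by rw [S_symm]; exact lift_S a)
          (clear_below a ih (Finset.Ioi a) (φ.trans (S a)) ?_ ?_ fun i hi his => ?_)
        · intro j hj
          simp [S_apply, h1 j hj, hj.ne']
          try simp [hj.ne]
        · simp [S_apply, hc]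
        · have := ha i (by simpa using his) hi
          simp [S_apply, this, hi]
    · set c := φ (Finsupp.single k 1) a with hcdef
      have hcc : c * c = 1 := by rcases hsq with h | h <;> simp [h]
      have hk0 := ha k le_rfl (Ne.symm hk)
      refine Lift.of_trans (lift_T_symm k a (Ne.symm hk) c)
        (clear_below k ih (insert a (Finset.Ioi k)) _ ?_ ?_ fun i hi his => ?_)
      · intro j hj
        have := (lt_of_le_of_lt hak hj).ne
        simp [T_apply, h1 j hj, this]
      · simp [T_apply, hk0, ← hcdef, hcc]
      · simp only [Finset.mem_insert, Finset.mem_Ioi, not_or, not_lt] at his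
        simp [T_apply, ha i his.2 his.1, hi]

lemma lift_aux {n : ℕ} (k : ℕ) (hk : k ≤ n) : ∀ φ : V n ≃+ V n,
    (∀ j : Fin n, k ≤ j.val → φ (Finsupp.single j 1) = Finsupp.single j 1) → Lift φ := by
  induction k with
  | zero =>
    intro φ h
    apply lift_of_gen _ 1
    intro i
    rw [h i (Nat.zero_le _)]
    simp [q_of]
  | succ k ih =>
    intro φ h
    exact column ⟨k, hk⟩ (fun φ' h' => ih (by omega) φ' fun j hj => h' j hj) _ φ
      (fun j hj => h j hj) rfl

lemma lift_all {n : ℕ} (φ : V n ≃+ V n) : Lift φ :=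
  lift_aux n le_rfl φ fun j hj => absurd j.2 (by omega)

noncomputable def e (n : ℕ) : Additive (Abelianization (FG n)) ≃+ V n :=
  FreeAbelianGroup.equivFinsupp (Fin n)

lemma e_of {n : ℕ} (x : FG n) :
    e n (Additive.ofMul (Abelianization.of x)) = (q n x).toAdd := by
  have : ((AddMonoidHom.toMultiplicativeRight (e n).toAddMonoidHom).comp Abelianization.of) = q n := by
    apply FreeGroup.ext_hom
    intro i
    rw [q_of]
    exact congrArg Multiplicative.ofAdd (FreeAbelianGroup.toFinsupp_of i)
  exact congrArg Multiplicative.toAdd (DFunLike.congr_fun this x)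

end AutAb

/-- For every `n ≥ 1`, the natural homomorphism `Aut(F_n) → Aut(F_n^{ab})` is
surjective: every automorphism of the abelianization lifts to an automorphism
of the free group. -/
theorem aut_to_autAb_surjective (n : ℕ) (hn : 1 ≤ n) :
    Function.Surjective ⇑(theta n) := by
  intro ψ
  obtain ⟨f, hf⟩ := AutAb.lift_all
    ((AutAb.e n).symm.trans ((MulEquiv.toAdditive ψ).trans (AutAb.e n)))
  refine ⟨f, ?_⟩
  ext y
  obtain ⟨x, rfl⟩ := QuotientGroup.mk_surjective y
  change Abelianization.of (f x) = ψ (Abelianization.of x)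
  have h := hf x
  rw [← AutAb.e_of, ← AutAb.e_of] at h
  simp only [AddEquiv.trans_apply, AddEquiv.symm_apply_apply] at h
  exact (AutAb.e n).injective h
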